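/- arXiv:2212.01522 — 2 statements merged into one kernel-verified Lean document; each statement's English description precedes it below -/
import Mathlib

section
/- Consider case (a). Let d > 0, q > 0, and r̂ ∈ ℝⁿ with r̂ᵢ > 0 for all i. Suppose φ ≫ 0 satisfies (dD + qQ + diag(r̂))φ = 0. Then φ₁ < φ₂ < ⋯ < φₙ, and for every k ∈ {1,…,n−1} one has dφ_{k+1} − (d+q)φ_k = −Σ_{i=1}^k r̂ᵢφᵢ < 0. -/
open Matrix Filter

/-- Case (a) diffusion matrix (hypothesis H1, stream-to-lake). -/
def Da (n : ℕ) : Matrix (Fin n) (Fin n) ℝ := fun i j =>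
  if (i : ℕ) + 1 = (j : ℕ) ∨ (j : ℕ) + 1 = (i : ℕ) then 1
  else if i = j then (if (i : ℕ) = 0 ∨ (i : ℕ) = n - 1 then -1 else -2)
  else 0

/-- Case (b) diffusion matrix (hypothesis H1*, stream-to-ocean). -/
def Db (n : ℕ) : Matrix (Fin n) (Fin n) ℝ := fun i j =>
  if (i : ℕ) + 1 = (j : ℕ) ∨ (j : ℕ) + 1 = (i : ℕ) then 1
  else if i = j then (if (i : ℕ) = 0 then -1 else -2)
  else 0

/-- Advection (drift) matrix Q. -/
def Qm (n : ℕ) : Matrix (Fin n) (Fin n) ℝ := fun i j =>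
  if (j : ℕ) + 1 = (i : ℕ) then 1 else if i = j then -1 else 0

theorem aux_sum (n m : ℕ) (h : m < n) (g : Fin n → ℝ) :
    ∑ j : Fin n, (if (j : ℕ) = m then g j else 0) = g ⟨m, h⟩ := by
  rw [Finset.sum_eq_single (⟨m, h⟩ : Fin n)]
  · simp
  · intro b _ hb
    rw [if_neg]
    intro hc
    exact hb (Fin.ext hc)
  · simp

theorem aux_zero (n m : ℕ) (h : n ≤ m) (g : Fin n → ℝ) :
    ∑ j : Fin n, (if (j : ℕ) = m then g j else 0) = 0 := by
  apply Finset.sum_eq_zero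
  intro j _
  rw [if_neg]
  have := j.2
  omega

theorem aux_row (n : ℕ) (d q : ℝ) (rhat φ : Fin n → ℝ)
    (heig : (d • Da n + q • Qm n + Matrix.diagonal rhat).mulVec φ = 0) (i : Fin n) :
    ∑ j : Fin n, (if (j : ℕ) + 1 = i then (d + q) * φ j else 0)
    + ∑ j : Fin n, (if (j : ℕ) = i + 1 then d * φ j else 0)
    + ∑ j : Fin n, (if (j : ℕ) = i then
      (d * (if (i : ℕ) = 0 ∨ (i : ℕ) = n - 1 then -1 else -2) - q + rhat i) * φ j else 0) = 0 := by
  have h := congrFun heig i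
  simp only [Matrix.mulVec, dotProduct, Pi.zero_apply] at h
  refine Eq.trans ?_ h
  rw [← Finset.sum_add_distrib, ← Finset.sum_add_distrib]
  apply Finset.sum_congr rfl
  intro j _
  simp only [Matrix.add_apply, Matrix.smul_apply, Da, Qm, Matrix.diagonal_apply, smul_eq_mul,
    Fin.ext_iff]
  split_ifs <;> first | omega | ring

theorem aux_first (n : ℕ) (hn : 1 < n) (d q : ℝ) (rhat φ : Fin n → ℝ)
    (heig : (d • Da n + q • Qm n + Matrix.diagonal rhat).mulVec φ = 0) :
    d * φ ⟨1, hn⟩ - (d + q) * φ ⟨0, by omega⟩ = - (rhat ⟨0, by omega⟩ * φ ⟨0, by omega⟩) := by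
  have h := aux_row n d q rhat φ heig ⟨0, by omega⟩
  simp only [Nat.add_eq_zero_iff, one_ne_zero, and_false, if_false, Finset.sum_const_zero,
    zero_add] at h
  rw [aux_sum n 1 hn, aux_sum n 0 (by omega)] at h
  simp only [true_or, if_true] at h
  linarith

theorem aux_mid (n k : ℕ) (hk : k + 2 < n) (d q : ℝ) (rhat φ : Fin n → ℝ)
    (heig : (d • Da n + q • Qm n + Matrix.diagonal rhat).mulVec φ = 0) :
    d * φ ⟨k + 2, hk⟩ - (d + q) * φ ⟨k + 1, by omega⟩ =
      d * φ ⟨k + 1, by omega⟩ - (d + q) * φ ⟨k, by omega⟩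
       - rhat ⟨k + 1, by omega⟩ * φ ⟨k + 1, by omega⟩ := by
  have h := aux_row n d q rhat φ heig ⟨k + 1, by omega⟩
  simp only [Nat.add_right_cancel_iff] at h
  rw [aux_sum n k (by omega), aux_sum n (k + 1 + 1) hk, aux_sum n (k + 1) (by omega),
    if_neg (by omega)] at h
  linarith

theorem aux_last (n k : ℕ) (hk : k + 2 = n) (d q : ℝ) (rhat φ : Fin n → ℝ)
    (heig : (d • Da n + q • Qm n + Matrix.diagonal rhat).mulVec φ = 0) :
    (d + q) * (φ ⟨k + 1, by omega⟩ - φ ⟨k, by omega⟩) =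
       rhat ⟨k + 1, by omega⟩ * φ ⟨k + 1, by omega⟩ := by
  have h := aux_row n d q rhat φ heig ⟨k + 1, by omega⟩
  simp only [Nat.add_right_cancel_iff] at h
  rw [aux_sum n k (by omega), aux_zero n (k + 1 + 1) (by omega), aux_sum n (k + 1) (by omega),
    if_pos (by omega)] at h
  linarith

/-- in case (a), if `(dD + qQ + diag r̂)φ = 0` with `r̂ ≫ 0` and `φ ≫ 0`,
then `φ₁ < φ₂ < ⋯ < φₙ` and `d φ_{k+1} - (d+q) φ_k = -∑_{i=1}^k r̂ᵢ φᵢ < 0`. -/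
theorem stmt_3 (n : ℕ) (hn : 2 ≤ n) (d q : ℝ) (hd : 0 < d) (hq : 0 < q)
    (rhat : Fin n → ℝ) (hr : ∀ i, 0 < rhat i)
    (φ : Fin n → ℝ) (hφ : ∀ i, 0 < φ i)
    (heig : (d • Da n + q • Qm n + Matrix.diagonal rhat).mulVec φ = 0) :
    StrictMono φ ∧
    ∀ k : ℕ, (hk : k + 1 < n) →
      d * φ ⟨k + 1, hk⟩ - (d + q) * φ ⟨k, by omega⟩ =
        -(∑ i ∈ Finset.univ.filter (fun i : Fin n => (i : ℕ) ≤ k), rhat i * φ i) ∧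
      d * φ ⟨k + 1, hk⟩ - (d + q) * φ ⟨k, by omega⟩ < 0 := by
  have inc : ∀ m k : ℕ, (hk : k + 2 + m = n) → φ ⟨k, by omega⟩ < φ ⟨k + 1, by omega⟩ := by
    intro m
    induction m with
    | zero =>
      intro k hk
      have h := aux_last n k hk d q rhat φ heig
      have hp := mul_pos (hr ⟨k + 1, by omega⟩) (hφ ⟨k + 1, by omega⟩)
      rw [← h] at hp
      have := pos_of_mul_pos_right hp (by linarith : (0:ℝ) ≤ d + q)
      linarith
    | succ m ih =>
      intro k hk
      have h := aux_mid n k (by omega) d q rhat φ heig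
      have hp := mul_pos (hr ⟨k + 1, by omega⟩) (hφ ⟨k + 1, by omega⟩)
      have h2 := mul_pos hd (sub_pos.2 (ih (k + 1) (by omega)))
      have h3 : 0 < (d + q) * (φ ⟨k + 1, by omega⟩ - φ ⟨k, by omega⟩) := by linarith
      have := pos_of_mul_pos_right h3 (by linarith : (0:ℝ) ≤ d + q)
      linarith
  have key : ∀ k : ℕ, (hk : k + 1 < n) →
      d * φ ⟨k + 1, hk⟩ - (d + q) * φ ⟨k, by omega⟩ =
        -(∑ i ∈ Finset.univ.filter (fun i : Fin n => (i : ℕ) ≤ k), rhat i * φ i) := by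
    intro k
    induction k with
    | zero =>
      intro hk
      have h := aux_first n hk d q rhat φ heig
      rw [Finset.sum_filter]
      simp only [Nat.le_zero]
      rw [aux_sum n 0 (by omega)]
      exact h
    | succ k ih =>
      intro hk
      rw [aux_mid n k hk d q rhat φ heig, ih (by omega), Finset.sum_filter, Finset.sum_filter,
        ← aux_sum n (k + 1) (by omega) (fun i => rhat i * φ i), neg_sub_left, add_comm,
        ← Finset.sum_add_distrib]
      congr 1
      apply Finset.sum_congr rfl
      intro j _
      split_ifs <;> first | omega | simp
  refine ⟨?_, fun k hk => ⟨key k hk, ?_⟩⟩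
  · have hh : ∀ m k : ℕ, (h : k + 1 + m < n) → φ ⟨k, by omega⟩ < φ ⟨k + 1 + m, h⟩ := by
      intro m
      induction m with
      | zero => intro k h; exact inc (n - (k + 2)) k (by omega)
      | succ m ih =>
        intro k h
        exact (ih k (by omega)).trans (inc (n - (k + 1 + m + 2)) (k + 1 + m) (by omega))
    intro a b hab
    have hab' : (a : ℕ) < b := hab
    have := hh (b - a - 1) a (by have := b.2; omega)
    have e : (⟨(a : ℕ) + 1 + (b - a - 1), by have := b.2; omega⟩ : Fin n) = b :=
      Fin.ext (by simp only []; omega)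
    rw [e] at this
    exact this
  · rw [key k hk, neg_lt_zero]
    apply Finset.sum_pos (fun i _ => mul_pos (hr i) (hφ i))
    exact ⟨⟨0, by omega⟩, by simp⟩
end

section
/- Consider case (a) and let r ∈ ℝⁿ with rᵢ > 0 for all i. (i) For every ε > 0 there exists δ > 0 such that: whenever 0 < d < δ, q > 0, and there exists φ ≫ 0 with (dD + qQ + diag(r))φ = 0, one has |q − max_{1≤i≤n} r_i| < ε. (ii) For every ε > 0 there exists M > 0 such that: whenever d > M, q > 0, and there exists φ ≫ 0 with (dD + qQ + diag(r))φ = 0, one has |q − Σ_{i=1}^n r_i| < ε. (That is, the critical advection rate q*_r(d) satisfies q*_r(d) → max_i r_i as d → 0 and q*_r(d) → Σ_i r_i as d → ∞.) -/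
open Matrix Filter

lemma row_aux (n : ℕ) (hn : 2 ≤ n) (r φ : Fin n → ℝ) (d q : ℝ)
    (h : (d • Da n + q • Qm n + Matrix.diagonal r).mulVec φ = 0) (f s : ℕ → ℝ)
    (hf : ∀ i : Fin n, f i = φ i) (hs : ∀ i : Fin n, s i = r i) (k : ℕ) (hk : k < n) :
    d * ((if k + 1 < n then f (k+1) - f k else 0) + (if 0 < k then f (k-1) - f k else 0))
      + q * ((if 0 < k then f (k-1) else 0) - f k) + s k * f k = 0 := by
  have h1 := congrFun h ⟨k, hk⟩
  simp only [Matrix.mulVec, dotProduct, Pi.zero_apply] at h1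
  have h2 : ∀ j : Fin n, (d • Da n + q • Qm n + Matrix.diagonal r) ⟨k, hk⟩ j * φ j =
      (fun j : ℕ => (if k + 1 = j then d * f j else 0)
        + (if k = j then
          (d * ((if k + 1 < n then -1 else 0) + (if 0 < k then -1 else 0)) - q + s k) * f j else 0)
        + (if 0 < k then (if k - 1 = j then (d + q) * f j else 0) else 0)) (j : ℕ) := by
    rintro ⟨j, hj⟩
    have e1 := hf ⟨j, hj⟩
    have e2 := hs ⟨k, hk⟩
    simp only at e1 e2
    simp only [Matrix.add_apply, Matrix.smul_apply, Da, Qm, Matrix.diagonal_apply, Fin.mk.injEq,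
      smul_eq_mul, ← e1, ← e2]
    split_ifs <;> first | omega | ring
  rw [Finset.sum_congr rfl (fun j _ => h2 j)] at h1
  rw [Fin.sum_univ_eq_sum_range (fun j : ℕ => (if k + 1 = j then d * f j else 0)
        + (if k = j then
          (d * ((if k + 1 < n then -1 else 0) + (if 0 < k then -1 else 0)) - q + s k) * f j else 0)
        + (if 0 < k then (if k - 1 = j then (d + q) * f j else 0) else 0))] at h1
  have hk1 : k - 1 < n := by omega
  by_cases h0 : 0 < k <;> by_cases h3 : k + 1 < n <;>
    simp [Finset.sum_add_distrib, h0, h3, hk, hk1] at h1 ⊢ <;> linarith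

lemma sum_aux (n : ℕ) (hn : 2 ≤ n) (r φ : Fin n → ℝ) (d q : ℝ)
    (h : (d • Da n + q • Qm n + Matrix.diagonal r).mulVec φ = 0) (f s : ℕ → ℝ)
    (hf : ∀ i : Fin n, f i = φ i) (hs : ∀ i : Fin n, s i = r i) (k : ℕ) (hk : k < n) :
    d * (if k + 1 < n then f (k+1) - f k else 0) + ∑ i ∈ Finset.range (k+1), s i * f i
      = q * f k := by
  induction k with
  | zero =>
    have := row_aux n hn r φ d q h f s hf hs 0 hk
    simp at this ⊢
    linarith
  | succ k ih =>
    have h1 := row_aux n hn r φ d q h f s hf hs (k+1) hk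
    have h2 := ih (by omega)
    rw [Finset.sum_range_succ]
    simp [hk] at h1 h2 ⊢
    split_ifs at h1 ⊢ <;> linarith

/-- The reduced system with natural-number indices. -/
lemma exists_aux (n : ℕ) (hn : 2 ≤ n) (r φ : Fin n → ℝ) (d q : ℝ)
    (hr : ∀ i, 0 < r i) (hφ : ∀ i, 0 < φ i)
    (h : (d • Da n + q • Qm n + Matrix.diagonal r).mulVec φ = 0) :
    ∃ f s : ℕ → ℝ, (∀ i : Fin n, s i = r i) ∧ (∀ k, k < n → 0 < f k) ∧ (∀ k, k < n → 0 < s k) ∧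
      (∀ k, k + 1 < n → d * (f (k+1) - f k) + ∑ i ∈ Finset.range (k+1), s i * f i = q * f k) ∧
      ∑ i ∈ Finset.range n, s i * f i = q * f (n-1) := by
  let f : ℕ → ℝ := fun k => if h : k < n then φ ⟨k, h⟩ else 0
  let s : ℕ → ℝ := fun k => if h : k < n then r ⟨k, h⟩ else 0
  have hf : ∀ i : Fin n, f i = φ i := fun i => by simp [f]
  have hs : ∀ i : Fin n, s i = r i := fun i => by simp [s]
  refine ⟨f, s, hs, fun k hk => ?_, fun k hk => ?_, fun k hk => ?_, ?_⟩
  · exact (hf ⟨k, hk⟩).symm ▸ hφ _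
  · exact (hs ⟨k, hk⟩).symm ▸ hr _
  · have := sum_aux n hn r φ d q h f s hf hs k (by omega)
    rwa [if_pos hk] at this
  · have := sum_aux n hn r φ d q h f s hf hs (n-1) (by omega)
    rw [if_neg (by omega), show n - 1 + 1 = n by omega] at this
    simpa using this

lemma lower_small (n : ℕ) (f s : ℕ → ℝ) (d q : ℝ) (hd : 0 < d) (hq : 0 < q)
    (hf : ∀ k, k < n → 0 < f k) (hs : ∀ k, k < n → 0 < s k)
    (h1 : ∀ k, k + 1 < n → d * (f (k+1) - f k) + ∑ i ∈ Finset.range (k+1), s i * f i = q * f k)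
    (h2 : ∑ i ∈ Finset.range n, s i * f i = q * f (n-1)) (k : ℕ) (hk : k < n) :
    s k - d ≤ q := by
  have hp : 0 ≤ ∑ i ∈ Finset.range k, s i * f i :=
    Finset.sum_nonneg fun i hi => by
      have := Finset.mem_range.1 hi
      exact (mul_pos (hs i (by omega)) (hf i (by omega))).le
  have hfk := hf k hk
  by_contra hc
  push Not at hc
  by_cases h3 : k + 1 < n
  · have := h1 k h3
    rw [Finset.sum_range_succ] at this
    have := mul_pos hd (hf _ h3)
    nlinarith
  · obtain rfl : n = k + 1 := by omega
    rw [Finset.sum_range_succ] at h2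
    simp only [Nat.add_sub_cancel] at h2
    nlinarith [mul_pos hd hfk]

lemma upper_small (n : ℕ) (hn : 2 ≤ n) (f s : ℕ → ℝ) (d q m ε : ℝ) (hd : 0 < d) (hε : 0 < ε)
    (hf : ∀ k, k < n → 0 < f k) (hm : ∀ k, k < n → s k ≤ m)
    (hde : (m + ε / 2) * d ≤ ε / 2 * (ε / 2)) (hm0 : 0 < m)
    (h1 : ∀ k, k + 1 < n → d * (f (k+1) - f k) + ∑ i ∈ Finset.range (k+1), s i * f i = q * f k)
    (h2 : ∑ i ∈ Finset.range n, s i * f i = q * f (n-1)) : q < m + ε := by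
  by_contra hc
  push Not at hc
  have key : ∀ k, k < n → ∑ i ∈ Finset.range k, s i * f i ≤ ε / 2 * f k := by
    intro k
    induction k with
    | zero =>
      intro hk
      have := hf 0 hk
      simp only [Finset.range_zero, Finset.sum_empty]
      positivity
    | succ k ih =>
      intro hk
      have h3 := ih (by omega)
      have h4 := h1 k hk
      have h5 := hf k (by omega)
      rw [Finset.sum_range_succ] at h4 ⊢
      have h6 : s k * f k ≤ m * f k := mul_le_mul_of_nonneg_right (hm k (by omega)) h5.le
      have h7 : (m + ε) * f k ≤ q * f k := mul_le_mul_of_nonneg_right hc h5.le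
      have h8 : ε / 2 * f k ≤ d * f (k+1) := by nlinarith [mul_pos hd h5]
      have h9 : (m + ε / 2) * (ε / 2 * f k) ≤ (m + ε / 2) * (d * f (k+1)) :=
        mul_le_mul_of_nonneg_left h8 (by positivity)
      have h10 : ((m + ε / 2) * d) * f (k+1) ≤ (ε / 2 * (ε / 2)) * f (k+1) :=
        mul_le_mul_of_nonneg_right hde (hf _ hk).le
      have h11 : (ε / 2) * ((m + ε / 2) * f k) ≤ (ε / 2) * (ε / 2 * f (k+1)) := by linarith
      have h12 := le_of_mul_le_mul_left h11 (by positivity)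
      linarith
  obtain ⟨k, rfl⟩ : ∃ k, n = k + 1 := ⟨n - 1, by omega⟩
  have h3 := key k (by omega)
  rw [Finset.sum_range_succ] at h2
  simp only [Nat.add_sub_cancel] at h2
  have h5 := hf k (by omega)
  have h6 : s k * f k ≤ m * f k := mul_le_mul_of_nonneg_right (hm k (by omega)) h5.le
  have h7 : (m + ε) * f k ≤ q * f k := mul_le_mul_of_nonneg_right hc h5.le
  nlinarith [mul_pos hε h5]

lemma large_aux (n : ℕ) (hn : 2 ≤ n) (f s : ℕ → ℝ) (d q R : ℝ) (hd : 0 < d) (hq : 0 < q)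
    (hf : ∀ k, k < n → 0 < f k) (hs : ∀ k, k < n → 0 < s k)
    (hR : R = ∑ i ∈ Finset.range n, s i)
    (h1 : ∀ k, k + 1 < n → d * (f (k+1) - f k) + ∑ i ∈ Finset.range (k+1), s i * f i = q * f k)
    (h2 : ∑ i ∈ Finset.range n, s i * f i = q * f (n-1)) :
    q ≤ R ∧ R * d - 2 * n * R ^ 2 ≤ q * d := by
  obtain ⟨p, hp, hmax⟩ := Finset.exists_max_image (Finset.range n) f ⟨0, by simp; omega⟩
  have hpn := Finset.mem_range.1 hp
  have hP := hf p hpn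
  have hmx : ∀ k, k < n → f k ≤ f p := fun k hk => hmax k (Finset.mem_range.2 hk)
  have hR0 : 0 < R := hR ▸ Finset.sum_pos (fun i hi => hs i (Finset.mem_range.1 hi)) ⟨p, hp⟩
  have hS0 : ∀ k, k ≤ n → 0 ≤ ∑ i ∈ Finset.range k, s i * f i := fun k hk =>
    Finset.sum_nonneg fun i hi => by
      have := Finset.mem_range.1 hi
      exact (mul_pos (hs i (by omega)) (hf i (by omega))).le
  have hS1 : ∀ k, k ≤ n → ∑ i ∈ Finset.range k, s i * f i ≤ R * f p := fun k hk => by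
    rw [hR, Finset.sum_mul]
    refine (Finset.sum_le_sum_of_subset_of_nonneg (Finset.range_mono hk) ?_).trans
      (Finset.sum_le_sum ?_)
    · intro i hi _
      have := Finset.mem_range.1 hi
      exact (mul_pos (hs i (by omega)) (hf i (by omega))).le
    · intro i hi
      have := Finset.mem_range.1 hi
      exact mul_le_mul_of_nonneg_left (hmx i this) (hs i this).le
  have hqR : q ≤ R := by
    refine le_of_mul_le_mul_right ?_ hP
    by_cases h3 : p + 1 < n
    · have := h1 p h3
      have := hS1 (p+1) (by omega)
      nlinarith [hmx _ h3]
    · obtain rfl : n = p + 1 := by omega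
      simp only [Nat.add_sub_cancel] at h2
      rw [← h2]
      exact hS1 _ le_rfl
  refine ⟨hqR, ?_⟩
  have hdiff : ∀ k, k < n → |d * (f k - f 0)| ≤ k * (R * f p) := by
    intro k
    induction k with
    | zero => intro; simp
    | succ k ih =>
      intro hk
      have h3 := abs_le.1 (ih (by omega))
      have h4 := h1 k hk
      have h5 := hS0 (k+1) (by omega)
      have h6 := hS1 (k+1) (by omega)
      have h7 : 0 ≤ q * f k := (mul_pos hq (hf k (by omega))).le
      have h8 : q * f k ≤ R * f p := mul_le_mul hqR (hmx k (by omega)) (hf k (by omega)).le hR0.le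
      push_cast
      rw [abs_le]
      constructor <;> linarith [h3.1, h3.2]
  have hRP : 0 < R * f p := mul_pos hR0 hP
  have hk : ∀ k, k < n → d * f p - 2 * n * (R * f p) ≤ d * f k := by
    intro k hk
    have a := abs_le.1 (hdiff k hk)
    have b := abs_le.1 (hdiff p hpn)
    have c1 : (k : ℝ) * (R * f p) ≤ n * (R * f p) :=
      mul_le_mul_of_nonneg_right (by exact_mod_cast hk.le) hRP.le
    have c2 : (p : ℝ) * (R * f p) ≤ n * (R * f p) :=
      mul_le_mul_of_nonneg_right (by exact_mod_cast hpn.le) hRP.le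
    linarith [a.1, b.2]
  have h3 : R * (d * f p - 2 * n * (R * f p)) ≤ d * (q * f (n-1)) := by
    rw [← h2, hR, Finset.sum_mul, Finset.mul_sum, ← hR]
    refine Finset.sum_le_sum fun i hi => ?_
    have hi := Finset.mem_range.1 hi
    have := mul_le_mul_of_nonneg_left (hk i hi) (hs i hi).le
    linarith
  have h4 : (d * q) * f (n-1) ≤ (d * q) * f p :=
    mul_le_mul_of_nonneg_left (hmx _ (by omega)) (by positivity)
  refine le_of_mul_le_mul_right ?_ hP
  linarith

/-- in case (a) with `r ≫ 0`, the critical advection rate satisfies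
`q*_r(d) → max_i r_i` as `d → 0` and `q*_r(d) → ∑ i, r i` as `d → ∞`. -/
theorem stmt_8 (n : ℕ) (hn : 2 ≤ n) (r : Fin n → ℝ) (hr : ∀ i, 0 < r i)
    (m : ℝ) (hm : IsGreatest (Set.range r) m) :
    (∀ ε : ℝ, 0 < ε → ∃ δ : ℝ, 0 < δ ∧ ∀ d q : ℝ, 0 < d → d < δ → 0 < q →
      (∃ φ : Fin n → ℝ, (∀ i, 0 < φ i) ∧
        (d • Da n + q • Qm n + Matrix.diagonal r).mulVec φ = 0) →
      |q - m| < ε) ∧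
    (∀ ε : ℝ, 0 < ε → ∃ M : ℝ, 0 < M ∧ ∀ d q : ℝ, M < d → 0 < q →
      (∃ φ : Fin n → ℝ, (∀ i, 0 < φ i) ∧
        (d • Da n + q • Qm n + Matrix.diagonal r).mulVec φ = 0) →
      |q - ∑ i, r i| < ε) := by
  obtain ⟨⟨i0, hi0⟩, hub⟩ := hm
  have hm0 : 0 < m := hi0 ▸ hr i0
  constructor
  · intro ε hε
    refine ⟨min ε (ε / 2 * (ε / 2) / (m + ε / 2)), by positivity, ?_⟩
    rintro d q hd hdδ hq ⟨φ, hφ, h⟩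
    obtain ⟨f, s, hsr, hf, hs, h1, h2⟩ := exists_aux n hn r φ d q hr hφ h
    have hd1 := hdδ.trans_le (min_le_left _ _)
    have hd2 := hdδ.trans_le (min_le_right _ _)
    rw [lt_div_iff₀ (by positivity)] at hd2
    have hl := lower_small n f s d q hd hq hf hs h1 h2 i0 i0.2
    rw [hsr, hi0] at hl
    have hu := upper_small n hn f s d q m ε hd hε hf
      (fun k hk => (hsr ⟨k, hk⟩).trans_le (hub ⟨_, rfl⟩)) (by linarith) hm0 h1 h2
    rw [abs_lt]
    constructor <;> linarith
  · intro ε hε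
    have hR0 : 0 < ∑ i, r i := Finset.sum_pos (fun i _ => hr i) ⟨i0, Finset.mem_univ _⟩
    have hn0 : (0 : ℝ) < n := by exact_mod_cast (by omega : 0 < n)
    refine ⟨2 * n * (∑ i, r i) ^ 2 / ε, by positivity, ?_⟩
    rintro d q hd hq ⟨φ, hφ, h⟩
    obtain ⟨f, s, hsr, hf, hs, h1, h2⟩ := exists_aux n hn r φ d q hr hφ h
    have hd0 : 0 < d := lt_trans (by positivity) hd
    have hR : ∑ i, r i = ∑ i ∈ Finset.range n, s i := by
      rw [← Fin.sum_univ_eq_sum_range]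
      exact Finset.sum_congr rfl fun i _ => (hsr i).symm
    obtain ⟨ha, hb⟩ := large_aux n hn f s d q _ hd0 hq hf hs hR h1 h2
    rw [div_lt_iff₀ hε] at hd
    rw [abs_lt]
    refine ⟨?_, by linarith⟩
    refine lt_of_mul_lt_mul_right ?_ hd0.le
    linarith
end
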